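/- Arveson's noncommutative Korovkin theorem: let π : C[0,1] → B(H) be a unital *-representation on a complex Hilbert space H, and let φ_n : C[0,1] → B(H) be a sequence of unital positive linear maps such that lim_{n→∞} ‖φ_n(g) − π(g)‖ = 0 for each g in {x, x²}. Then lim_{n→∞} ‖φ_n(f) − π(f)‖ = 0 for every f ∈ C[0,1]. -/

import Mathlib

open Filter
open scoped ComplexOrder

/-- The function `t ↦ t` as a continuous complex-valued map on `[0,1]`. -/
noncomputable def korovkinX : C(Set.Icc (0:ℝ) 1, ℂ) :=
  ⟨fun t => ((t : ℝ) : ℂ), Complex.continuous_ofReal.comp continuous_subtype_val⟩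

open scoped unitInterval InnerProductSpace

section PositiveMaps

variable {H : Type*} [NormedAddCommGroup H] [InnerProductSpace ℂ H]

/-- A symmetric operator whose quadratic form is bounded by `c` has norm at most `c`. -/
lemma opNorm_le_of_abs_re_inner_le {T : H →L[ℂ] H} (hT : (T : H →ₗ[ℂ] H).IsSymmetric)
    {c : ℝ} (hc : 0 ≤ c) (h : ∀ x, |(⟪T x, x⟫_ℂ).re| ≤ c * ‖x‖ ^ 2) : ‖T‖ ≤ c := by
  rw [T.norm_eq_iSup_rayleighQuotient hT]
  refine ciSup_le fun x => ?_
  rw [ContinuousLinearMap.rayleighQuotient, ContinuousLinearMap.reApplyInnerSelf, abs_div, abs_sq]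
  exact div_le_of_le_mul₀ (sq_nonneg _) hc (h x)

variable {ψ : C(I, ℝ) →ₗ[ℝ] (H →L[ℂ] H)}

lemma norm_smul_one_add_nonneg (f : C(I, ℝ)) : 0 ≤ ‖f‖ • 1 + f := by
  refine ContinuousMap.le_def.2 fun x => ?_
  have := (abs_le.1 (f.norm_coe_le_norm x)).1
  simp only [ContinuousMap.zero_apply, ContinuousMap.add_apply, ContinuousMap.smul_apply,
    ContinuousMap.one_apply, smul_eq_mul, mul_one]
  linarith

/-- A positive map sends real functions to symmetric operators. -/
lemma isSymmetric_of_positive (h1 : ψ 1 = 1) (hp : ∀ f, 0 ≤ f → (ψ f).IsPositive)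
    (f : C(I, ℝ)) : (ψ f : H →ₗ[ℂ] H).IsSymmetric := by
  have hs := (hp _ (norm_smul_one_add_nonneg f)).isSymmetric
  intro x y
  have := hs x y
  simpa [h1, inner_add_left, inner_add_right, inner_smul_left_eq_smul,
    inner_smul_right_eq_smul] using this

/-- A unital positive map is contractive on real functions. -/
lemma norm_apply_le_of_positive (h1 : ψ 1 = 1) (hp : ∀ f, 0 ≤ f → (ψ f).IsPositive)
    (f : C(I, ℝ)) : ‖ψ f‖ ≤ ‖f‖ := by
  refine opNorm_le_of_abs_re_inner_le (isSymmetric_of_positive h1 hp f) (norm_nonneg _) fun x => ?_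
  have hb : 0 ≤ ‖f‖ • 1 - f := by simpa [sub_eq_add_neg] using norm_smul_one_add_nonneg (-f)
  have h2 := (hp _ (norm_smul_one_add_nonneg f)).re_inner_nonneg_left x
  have h3 := (hp _ hb).re_inner_nonneg_left x
  have hn : (⟪x, x⟫_ℂ).re = ‖x‖ ^ 2 := inner_self_eq_norm_sq (𝕜 := ℂ) x
  simp only [map_add, map_sub, map_smul, h1, add_apply,
    sub_apply, smul_apply, one_apply_eq_self,
    inner_add_left, inner_sub_left, inner_smul_left_eq_smul, RCLike.re_to_complex,
    Complex.smul_re, hn, smul_eq_mul] at h2 h3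
  exact abs_le.2 ⟨by linarith, by linarith⟩

lemma bernsteinApproximation_eq_sum_smul (N : ℕ) (f : C(I, ℝ)) :
    bernsteinApproximation N f =
      ∑ k : Fin (N + 1), f (bernstein.z k) • bernstein N k := by
  ext x
  simp [bernsteinApproximation.apply, mul_comm]

/-- Positivity of the operator matrix with entries `ψ (g * g)`, `ψ g`, `ψ g`, `ψ 1`. -/
lemma re_inner_add_nonneg_of_positive (h1 : ψ 1 = 1) (hp : ∀ f, 0 ≤ f → (ψ f).IsPositive)
    (g : C(I, ℝ)) (ξ η : H) :
    0 ≤ (⟪ψ (g * g) ξ, ξ⟫_ℂ).re + 2 * (⟪ψ g ξ, η⟫_ℂ).re + (⟪η, η⟫_ℂ).re := by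
  have hcont : Continuous ψ :=
    (LinearMap.mkContinuous ψ 1 fun f => by
      simpa using norm_apply_le_of_positive h1 hp f).continuous
  let B (u v w : C(I, ℝ)) : ℝ :=
    (⟪ψ u ξ, ξ⟫_ℂ).re + 2 * (⟪ψ v ξ, η⟫_ℂ).re + (⟪ψ w η, η⟫_ℂ).re
  have hB : Continuous fun p : C(I, ℝ) × C(I, ℝ) × C(I, ℝ) => B p.1 p.2.1 p.2.2 := by
    simp only [B]
    fun_prop
  have hlim := (hB.tendsto (g * g, g, 1)).comp
    ((bernsteinApproximation_uniform (g * g)).prodMk_nhds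
      ((bernsteinApproximation_uniform g).prodMk_nhds (bernsteinApproximation_uniform 1)))
  have hnonneg : ∀ N, 0 ≤ B (bernsteinApproximation N (g * g)) (bernsteinApproximation N g)
      (bernsteinApproximation N 1) := fun N => by
    have hk : ∀ k : Fin (N + 1), 0 ≤ g (bernstein.z k) * g (bernstein.z k) *
        (⟪ψ (bernstein N k) ξ, ξ⟫_ℂ).re + 2 * (g (bernstein.z k) *
        (⟪ψ (bernstein N k) ξ, η⟫_ℂ).re) + (⟪ψ (bernstein N k) η, η⟫_ℂ).re := fun k => by
      have hpk := hp (bernstein N k) fun x => bernstein_nonneg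
      have h := hpk.re_inner_nonneg_left (g (bernstein.z k) • ξ + η)
      have hsymm : (⟪ψ (bernstein N k) η, ξ⟫_ℂ).re = (⟪ψ (bernstein N k) ξ, η⟫_ℂ).re := by
        rw [hpk.inner_left_eq_inner_right, ← inner_conj_symm, Complex.conj_re]
      rw [← Complex.coe_smul] at h
      simp only [map_add, ContinuousLinearMap.map_smul_of_tower, inner_add_left,
        inner_add_right, Complex.coe_smul,
        inner_smul_left_eq_smul, inner_smul_right_eq_smul, RCLike.re_to_complex, Complex.add_re,
        Complex.smul_re, smul_eq_mul, hsymm] at h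
      linarith
    have hsum := Finset.sum_nonneg fun k (_ : k ∈ Finset.univ) => hk k
    simp only [B, bernsteinApproximation_eq_sum_smul, map_sum, map_smul,
      sum_apply, smul_apply, sum_inner,
      inner_smul_left_eq_smul, Complex.re_sum, Complex.smul_re, smul_eq_mul]
    simpa [Finset.sum_add_distrib, Finset.mul_sum] using hsum
  have := ge_of_tendsto' hlim hnonneg
  simpa [B, h1] using this

/-- **Kadison's inequality** for unital positive maps on `C[0,1]`. -/
lemma norm_apply_sq_le_re_inner (h1 : ψ 1 = 1) (hp : ∀ f, 0 ≤ f → (ψ f).IsPositive)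
    (g : C(I, ℝ)) (ξ : H) : ‖ψ g ξ‖ ^ 2 ≤ (⟪ψ (g * g) ξ, ξ⟫_ℂ).re := by
  have h := re_inner_add_nonneg_of_positive h1 hp g ξ (-ψ g ξ)
  have hn : (⟪ψ g ξ, ψ g ξ⟫_ℂ).re = ‖ψ g ξ‖ ^ 2 := inner_self_eq_norm_sq (𝕜 := ℂ) _
  simp only [inner_neg_left, inner_neg_right, neg_neg, Complex.neg_re, hn] at h
  linarith

/-- The Cauchy–Schwarz inequality for the defect in Kadison's inequality. -/
lemma norm_two_smul_apply_mul_sub_le (h1 : ψ 1 = 1) (hp : ∀ f, 0 ≤ f → (ψ f).IsPositive)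
    (f g : C(I, ℝ)) :
    ‖(2 : ℝ) • ψ (f * g) - (ψ f * ψ g + ψ g * ψ f)‖ ≤
      2 * √‖ψ (f * f) - ψ f * ψ f‖ * ‖g‖ := by
  have hs := isSymmetric_of_positive h1 hp
  have hsym : ∀ (u : C(I, ℝ)) (x y : H), ⟪ψ u x, y⟫_ℂ = ⟪x, ψ u y⟫_ℂ := fun u x y => hs u x y
  refine opNorm_le_of_abs_re_inner_le ?_ (by positivity) fun ξ => ?_
  · intro x y
    simp [inner_add_left, inner_add_right, inner_sub_left, inner_sub_right,
      inner_smul_left_eq_smul, inner_smul_right_eq_smul, hsym]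
    ring
  set a := (⟪(ψ (f * f) - ψ f * ψ f) ξ, ξ⟫_ℂ).re with ha
  set b := (⟪((2 : ℝ) • ψ (f * g) - (ψ f * ψ g + ψ g * ψ f)) ξ, ξ⟫_ℂ).re with hb
  set c := (⟪(ψ (g * g) - ψ g * ψ g) ξ, ξ⟫_ℂ).re with hc
  have hquad : ∀ t : ℝ, 0 ≤ a * (t * t) + b * t + c := fun t => by
    have h := norm_apply_sq_le_re_inner h1 hp (t • f + g) ξ
    rw [← inner_self_eq_norm_sq (𝕜 := ℂ), hsym, ← hsym] at h
    have hexp : (t • f + g) * (t • f + g) = (t * t) • (f * f) + (2 * t) • (f * g) + g * g := by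
      ext x
      simp
      ring
    rw [hexp] at h
    simp only [ha, hb, hc, map_add, map_smul, add_apply,
      sub_apply, smul_apply,
      mul_apply_eq_comp, inner_add_left, inner_add_right, inner_sub_left,
      inner_smul_left_eq_smul, inner_smul_right_eq_smul, RCLike.re_to_complex, Complex.add_re,
      Complex.sub_re, Complex.smul_re, smul_eq_mul, hsym] at h ⊢
    linarith
  have hdisc := discrim_le_zero hquad
  have hale : a ≤ ‖ψ (f * f) - ψ f * ψ f‖ * ‖ξ‖ ^ 2 := by
    refine (Complex.re_le_norm _).trans ((norm_inner_le_norm _ _).trans ?_)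
    rw [sq, ← mul_assoc]
    gcongr
    exact ContinuousLinearMap.le_opNorm _ _
  have hc0 : 0 ≤ c := by simpa using hquad 0
  have hcle : c ≤ ‖g‖ ^ 2 * ‖ξ‖ ^ 2 := by
    have h2 : c = (⟪ψ (g * g) ξ, ξ⟫_ℂ).re - ‖ψ g ξ‖ ^ 2 := by
      rw [← inner_self_eq_norm_sq (𝕜 := ℂ)]
      simp [hc, hsym]
    have h3 : (⟪ψ (g * g) ξ, ξ⟫_ℂ).re ≤ ‖g‖ ^ 2 * ‖ξ‖ ^ 2 := by
      refine (Complex.re_le_norm _).trans ((norm_inner_le_norm _ _).trans ?_)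
      rw [sq ‖ξ‖, ← mul_assoc]
      gcongr
      refine ContinuousLinearMap.le_of_opNorm_le _ ?_ _
      refine (norm_apply_le_of_positive h1 hp _).trans ?_
      rw [sq]
      exact norm_mul_le _ _
    linarith [sq_nonneg ‖ψ g ξ‖]
  refine abs_le_of_sq_le_sq ?_ (by positivity)
  have hac : a * c ≤ ‖ψ (f * f) - ψ f * ψ f‖ * ‖ξ‖ ^ 2 * (‖g‖ ^ 2 * ‖ξ‖ ^ 2) :=
    mul_le_mul hale hcle hc0 (by positivity)
  have hsq := Real.sq_sqrt (norm_nonneg (ψ (f * f) - ψ f * ψ f))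
  rw [discrim] at hdisc
  calc b ^ 2 ≤ 4 * (a * c) := by linarith
    _ ≤ 4 * (‖ψ (f * f) - ψ f * ψ f‖ * ‖ξ‖ ^ 2 * (‖g‖ ^ 2 * ‖ξ‖ ^ 2)) := by gcongr
    _ = _ := by simp only [mul_pow, hsq]; ring

end PositiveMaps

section Convergence

variable {H : Type*} [NormedAddCommGroup H] [InnerProductSpace ℂ H]
  {ψ : ℕ → C(I, ℝ) →ₗ[ℝ] (H →L[ℂ] H)} {ρ : C(I, ℝ) →ₐ[ℝ] (H →L[ℂ] H)}

/-- If unital positive maps converge to a homomorphism at `f` and `f * f`, then convergence at `g`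
implies convergence at `f * g`. -/
lemma tendsto_apply_mul_of_positive (h1 : ∀ n, ψ n 1 = 1)
    (hp : ∀ n f, 0 ≤ f → (ψ n f).IsPositive) {f g : C(I, ℝ)}
    (hf : Tendsto (fun n => ψ n f) atTop (nhds (ρ f)))
    (hff : Tendsto (fun n => ψ n (f * f)) atTop (nhds (ρ (f * f))))
    (hg : Tendsto (fun n => ψ n g) atTop (nhds (ρ g))) :
    Tendsto (fun n => ψ n (f * g)) atTop (nhds (ρ (f * g))) := by
  have hD : Tendsto (fun n => 2 * √‖ψ n (f * f) - ψ n f * ψ n f‖ * ‖g‖) atTop (nhds 0) := by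
    have := ((hff.sub (hf.mul hf)).norm.sqrt.const_mul 2).mul_const ‖g‖
    simpa using this
  have hE := squeeze_zero_norm (fun n => norm_two_smul_apply_mul_sub_le (h1 n) (hp n) f g) hD
  have h := (hE.add ((hf.mul hg).add (hg.mul hf))).const_smul (2⁻¹ : ℝ)
  have hlim : (2⁻¹ : ℝ) • (0 + (ρ f * ρ g + ρ g * ρ f)) = ρ (f * g) := by
    rw [← map_mul, ← map_mul, mul_comm g f, ← two_smul ℝ, zero_add, inv_smul_smul₀ two_ne_zero]
  rw [hlim] at h
  refine h.congr fun n => ?_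
  rw [sub_add_cancel, inv_smul_smul₀ two_ne_zero]

/-- The Korovkin theorem for real functions. -/
lemma tendsto_apply_of_positive (h1 : ∀ n, ψ n 1 = 1)
    (hp : ∀ n f, 0 ≤ f → (ψ n f).IsPositive) (hρ : ∀ f, ‖ρ f‖ ≤ ‖f‖) {X : C(I, ℝ)}
    (hX : ∀ t, X t = t)
    (hx : Tendsto (fun n => ψ n X) atTop (nhds (ρ X)))
    (hxx : Tendsto (fun n => ψ n (X * X)) atTop (nhds (ρ (X * X)))) (f : C(I, ℝ)) :
    Tendsto (fun n => ψ n f) atTop (nhds (ρ f)) := by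
  have hpow : ∀ k : ℕ, Tendsto (fun n => ψ n (X ^ k)) atTop (nhds (ρ (X ^ k))) := fun k => by
    induction k with
    | zero => simp [h1]
    | succ k ih =>
      rw [pow_succ']
      exact tendsto_apply_mul_of_positive h1 hp hx hxx ih
  have hpoly : ∀ p : Polynomial ℝ, Tendsto (fun n => ψ n (p.toContinuousMapOn I)) atTop
      (nhds (ρ (p.toContinuousMapOn I))) := fun p => by
    have hsum : p.toContinuousMapOn I = ∑ k ∈ p.support, p.coeff k • X ^ k := by
      ext t
      simp [Polynomial.eval_eq_sum, Polynomial.sum, hX]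
    simp only [hsum, map_sum, map_smul]
    exact tendsto_finsetSum _ fun k _ => (hpow k).const_smul _
  rw [Metric.tendsto_atTop]
  intro ε hε
  obtain ⟨p, hpf⟩ := exists_polynomial_near_continuousMap 0 1 f (ε / 3) (by positivity)
  obtain ⟨N, hN⟩ := Metric.tendsto_atTop.1 (hpoly p) (ε / 3) (by positivity)
  refine ⟨N, fun n hn => ?_⟩
  have h2 := hN n hn
  set q := p.toContinuousMapOn I
  have h3 : dist (ψ n f) (ψ n q) < ε / 3 := by
    rw [dist_comm, dist_eq_norm, ← map_sub]
    exact (norm_apply_le_of_positive (h1 n) (hp n) _).trans_lt hpf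
  have h4 : dist (ρ q) (ρ f) < ε / 3 := by
    rw [dist_eq_norm, ← map_sub]
    exact (hρ _).trans_lt hpf
  linarith [dist_triangle4 (ψ n f) (ψ n q) (ρ q) (ρ f)]

end Convergence

/-- The inclusion of real functions into complex functions on `[0,1]`. -/
noncomputable def complexification : C(I, ℝ) →ₐ[ℝ] C(I, ℂ) :=
  Complex.ofRealAm.compLeftContinuous ℝ Complex.continuous_ofReal

@[simp]
lemma complexification_apply (f : C(I, ℝ)) (t : I) : complexification f t = (f t : ℂ) := rfl

lemma norm_complexification (f : C(I, ℝ)) : ‖complexification f‖ = ‖f‖ := by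
  simp [ContinuousMap.norm_eq_iSup_norm]

/-- **Arveson's noncommutative Korovkin theorem.** If `π : C[0,1] → B(H)` is a unital
*-representation and `φₙ : C[0,1] → B(H)` is a sequence of unital positive linear maps with
`‖φₙ(g) - π(g)‖ → 0` for `g ∈ {x, x²}`, then `‖φₙ(f) - π(f)‖ → 0` for every `f ∈ C[0,1]`. -/
theorem arveson_korovkin {H : Type*} [NormedAddCommGroup H] [InnerProductSpace ℂ H]
    [CompleteSpace H]
    (π : C(Set.Icc (0:ℝ) 1, ℂ) →⋆ₐ[ℂ] (H →L[ℂ] H))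
    (φ : ℕ → (C(Set.Icc (0:ℝ) 1, ℂ) →ₗ[ℂ] (H →L[ℂ] H)))
    (hunital : ∀ n, φ n 1 = 1)
    (hpos : ∀ (n : ℕ) (f : C(Set.Icc (0:ℝ) 1, ℂ)),
      (∀ x, 0 ≤ f x) → (φ n f).IsPositive)
    (hx : Tendsto (fun n => ‖φ n korovkinX - π korovkinX‖) atTop (nhds 0))
    (hx2 : Tendsto (fun n => ‖φ n (korovkinX * korovkinX) - π (korovkinX * korovkinX)‖)
      atTop (nhds 0)) :
    ∀ f : C(Set.Icc (0:ℝ) 1, ℂ),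
      Tendsto (fun n => ‖φ n f - π f‖) atTop (nhds 0) := by
  have hcoord : complexification ⟨Subtype.val, continuous_subtype_val⟩ = korovkinX := rfl
  have hreal : ∀ f : C(I, ℝ), Tendsto (fun n => φ n (complexification f)) atTop
      (nhds (π (complexification f))) := fun f => by
    refine tendsto_apply_of_positive
      (ψ := fun n => (φ n).restrictScalars ℝ ∘ₗ complexification.toLinearMap)
      (ρ := (π.toAlgHom.restrictScalars ℝ).comp complexification)
      (X := ⟨Subtype.val, continuous_subtype_val⟩) ?_ ?_ ?_ (fun _ => rfl) ?_ ?_ f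
    · intro n
      simp [hunital]
    · intro n f hf
      refine hpos n _ fun x => ?_
      exact Complex.zero_le_real.2 (hf x)
    · intro f
      rw [← norm_complexification f]
      exact NonUnitalStarAlgHom.norm_apply_le π (complexification f)
    · exact tendsto_iff_norm_sub_tendsto_zero.2 hx
    · rw [tendsto_iff_norm_sub_tendsto_zero]
      simpa [hcoord] using hx2
  intro f
  rw [← tendsto_iff_norm_sub_tendsto_zero]
  have hdecomp : f = complexification ⟨fun t => (f t).re, by fun_prop⟩ +
      Complex.I • complexification ⟨fun t => (f t).im, by fun_prop⟩ := by
    ext t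
    simp [mul_comm Complex.I, Complex.re_add_im]
  rw [hdecomp]
  simp only [map_add, map_smul]
  exact (hreal _).add ((hreal _).const_smul Complex.I)
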